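/- Let (V, V⁺, e_V) and (W, W⁺, e_W) be real AOU spaces. Then the order norms on the injective tensor product V ⊗_ε W and on the projective tensor product V ⊗_π W are cross norms with respect to the order norms of V and W, i.e. ‖v ⊗ w‖_{V⊗_εW} = ‖v‖·‖w‖ and ‖v ⊗ w‖_{V⊗_πW} = ‖v‖·‖w‖ for all v ∈ V, w ∈ W; moreover ‖z‖_{V⊗_εW} ≤ ‖z‖_{V⊗_πW} for every z ∈ V ⊗ W. -/

import Mathlib

open TensorProduct

/-- A real AOU space structure on a real vector space `V`: a proper cone together with
an Archimedean order unit. -/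
structure AOU (V : Type*) [AddCommGroup V] [Module ℝ V] where
  pos : Set V
  unit : V
  zero_mem : (0 : V) ∈ pos
  add_mem : ∀ ⦃x y : V⦄, x ∈ pos → y ∈ pos → x + y ∈ pos
  smul_mem : ∀ ⦃r : ℝ⦄, 0 ≤ r → ∀ ⦃x : V⦄, x ∈ pos → r • x ∈ pos
  proper : ∀ x : V, x ∈ pos → -x ∈ pos → x = 0
  exists_orderUnit : ∀ v : V, ∃ r : ℝ, 0 < r ∧ r • unit - v ∈ pos
  arch : ∀ v : V, (∀ ε : ℝ, 0 < ε → ε • unit + v ∈ pos) → v ∈ pos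

variable {V W : Type*} [AddCommGroup V] [Module ℝ V] [AddCommGroup W] [Module ℝ W]

/-- A state on a real AOU space: a unital positive linear functional. -/
def IsState (A : AOU V) (f : V →ₗ[ℝ] ℝ) : Prop :=
  f A.unit = 1 ∧ ∀ v ∈ A.pos, 0 ≤ f v

/-- The tensor product functional `f ⊗ g` on `V ⊗ W`, with `(f ⊗ g)(v ⊗ w) = f v * g w`. -/
noncomputable def tensFun (f : V →ₗ[ℝ] ℝ) (g : W →ₗ[ℝ] ℝ) :
    TensorProduct ℝ V W →ₗ[ℝ] ℝ :=
  TensorProduct.lift (f.smulRight g)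

/-- The injective cone `(V ⊗_ε W)⁺`. -/
def injCone (A : AOU V) (B : AOU W) : Set (TensorProduct ℝ V W) :=
  {z | ∀ (f : V →ₗ[ℝ] ℝ) (g : W →ₗ[ℝ] ℝ), IsState A f → IsState B g → 0 ≤ tensFun f g z}

/-- The set `V⁺ ⊗ W⁺` of finite sums of elementary tensors of positive elements. -/
def simpleCone (A : AOU V) (B : AOU W) : Set (TensorProduct ℝ V W) :=
  {z | ∃ (n : ℕ) (v : Fin n → V) (w : Fin n → W),
    (∀ i, v i ∈ A.pos) ∧ (∀ i, w i ∈ B.pos) ∧ z = ∑ i, v i ⊗ₜ[ℝ] w i}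

/-- The projective cone `(V ⊗_π W)⁺`. -/
def projCone (A : AOU V) (B : AOU W) : Set (TensorProduct ℝ V W) :=
  {z | ∀ ε : ℝ, 0 < ε → z + ε • (A.unit ⊗ₜ[ℝ] B.unit) ∈ simpleCone A B}

/-- The order norm determined by a cone `pos` and order unit `e`. -/
noncomputable def gNorm {X : Type*} [AddCommGroup X] [Module ℝ X]
    (pos : Set X) (e : X) (x : X) : ℝ :=
  sInf {r : ℝ | 0 < r ∧ r • e - x ∈ pos ∧ r • e + x ∈ pos}

namespace AOU

variable (A : AOU V)

lemma unit_mem : A.unit ∈ A.pos := by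
  obtain ⟨r, hr, h⟩ := A.exists_orderUnit 0
  have h' := A.smul_mem (inv_nonneg.2 hr.le) h
  rwa [sub_zero, smul_smul, inv_mul_cancel₀ hr.ne', one_smul] at h'

lemma eq_zero_of_unit_eq_zero (h : A.unit = 0) (v : V) : v = 0 := by
  obtain ⟨r, -, hr⟩ := A.exists_orderUnit v
  obtain ⟨s, -, hs⟩ := A.exists_orderUnit (-v)
  rw [h, smul_zero, zero_sub] at hr hs
  exact A.proper v (by simpa using hs) hr

lemma exists_bound (v : V) :
    {r : ℝ | 0 < r ∧ r • A.unit - v ∈ A.pos ∧ r • A.unit + v ∈ A.pos}.Nonempty := by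
  obtain ⟨r, hr, h₁⟩ := A.exists_orderUnit v
  obtain ⟨s, hs, h₂⟩ := A.exists_orderUnit (-v)
  refine ⟨r + s, by positivity, ?_, ?_⟩
  · have := A.add_mem h₁ (A.smul_mem hs.le A.unit_mem)
    convert this using 1; module
  · have := A.add_mem h₂ (A.smul_mem hr.le A.unit_mem)
    convert this using 1; module

/-- The least upper multiple of the order unit dominating `v`. -/
noncomputable def gauge (v : V) : ℝ := sInf {t : ℝ | t • A.unit - v ∈ A.pos}

lemma gauge_set_nonempty (v : V) : {t : ℝ | t • A.unit - v ∈ A.pos}.Nonempty := by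
  obtain ⟨r, -, h⟩ := A.exists_orderUnit v
  exact ⟨r, h⟩

variable {A}

lemma gauge_set_bddBelow (he : A.unit ≠ 0) (v : V) :
    BddBelow {t : ℝ | t • A.unit - v ∈ A.pos} := by
  obtain ⟨s, -, hs⟩ := A.exists_orderUnit (-v)
  refine ⟨-s, fun t ht => ?_⟩
  by_contra! hlt
  have hpos : 0 < -(t + s) := by linarith
  have h := A.smul_mem (inv_nonneg.2 hpos.le) (A.add_mem ht hs)
  refine he (A.proper _ A.unit_mem ?_)
  convert h using 1
  rw [show t • A.unit - v + (s • A.unit - -v) = (-(t + s)) • -A.unit by module, smul_smul,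
    inv_mul_cancel₀ hpos.ne', one_smul]

lemma gauge_le (he : A.unit ≠ 0) {v : V} {t : ℝ} (h : t • A.unit - v ∈ A.pos) :
    A.gauge v ≤ t :=
  csInf_le (gauge_set_bddBelow he v) h

lemma mem_of_gauge_lt {v : V} {t : ℝ} (h : A.gauge v < t) : t • A.unit - v ∈ A.pos := by
  obtain ⟨s, hs, hst⟩ := exists_lt_of_csInf_lt (A.gauge_set_nonempty v) h
  have := A.add_mem hs (A.smul_mem (sub_nonneg.2 hst.le) A.unit_mem)
  convert this using 1; module

lemma gauge_add_le (he : A.unit ≠ 0) (v w : V) :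
    A.gauge (v + w) ≤ A.gauge v + A.gauge w := by
  refine le_of_forall_pos_le_add fun ε hε => gauge_le he ?_
  have := A.add_mem (mem_of_gauge_lt (show A.gauge v < A.gauge v + ε / 2 by linarith))
    (mem_of_gauge_lt (show A.gauge w < A.gauge w + ε / 2 by linarith))
  convert this using 1; module

lemma gauge_smul_le (he : A.unit ≠ 0) {c : ℝ} (hc : 0 < c) (v : V) :
    A.gauge (c • v) ≤ c * A.gauge v := by
  rw [← div_le_iff₀' hc]
  refine le_csInf (A.gauge_set_nonempty v) fun t ht => ?_
  rw [div_le_iff₀' hc]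
  refine gauge_le he ?_
  have := A.smul_mem hc.le ht
  convert this using 1; module

lemma gauge_smul (he : A.unit ≠ 0) {c : ℝ} (hc : 0 < c) (v : V) :
    A.gauge (c • v) = c * A.gauge v := by
  refine le_antisymm (gauge_smul_le he hc v) ?_
  have h := gauge_smul_le he (inv_pos.2 hc) (c • v)
  rw [smul_smul, inv_mul_cancel₀ hc.ne', one_smul] at h
  rwa [← div_eq_inv_mul, le_div_iff₀' hc] at h

lemma gauge_zero (he : A.unit ≠ 0) : A.gauge 0 = 0 := by
  have h := gauge_smul he (two_pos : (0 : ℝ) < 2) 0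
  rw [smul_zero] at h
  linarith

lemma gauge_neg_add_nonneg (he : A.unit ≠ 0) (v : V) : 0 ≤ A.gauge v + A.gauge (-v) := by
  have h := gauge_add_le he v (-v)
  rwa [add_neg_cancel, gauge_zero he] at h

lemma mul_gauge_le (he : A.unit ≠ 0) (c : ℝ) (v : V) : c * A.gauge v ≤ A.gauge (c • v) := by
  rcases lt_trichotomy c 0 with hc | rfl | hc
  · have h := gauge_neg_add_nonneg he (c • v)
    rw [← neg_smul, gauge_smul he (neg_pos.2 hc)] at h
    linarith
  · simp [gauge_zero he]
  · exact (gauge_smul he hc v).ge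

lemma isState_of_le_gauge (he : A.unit ≠ 0) {f : V →ₗ[ℝ] ℝ} (hf : ∀ v, f v ≤ A.gauge v) :
    IsState A f := by
  refine ⟨le_antisymm ?_ ?_, fun v hv => ?_⟩
  · exact (hf _).trans (gauge_le he (by simpa using A.zero_mem))
  · have h := (hf (-A.unit)).trans (gauge_le he (t := -1) (by simpa using A.zero_mem))
    rw [map_neg] at h
    linarith
  · have h := (hf (-v)).trans (gauge_le he (t := 0) (by simpa using hv))
    rw [map_neg] at h
    linarith

lemma exists_state_eq_gauge (he : A.unit ≠ 0) {v : V} (hv : v ≠ 0) :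
    ∃ f : V →ₗ[ℝ] ℝ, IsState A f ∧ f v = A.gauge v := by
  obtain ⟨f, hf, hle⟩ := exists_extension_of_le_sublinear
    (LinearPMap.mkSpanSingleton v (A.gauge v) hv) A.gauge (fun c hc x => gauge_smul he hc x)
    (gauge_add_le he) (by
      rintro ⟨x, hx⟩
      obtain ⟨c, rfl⟩ := Submodule.mem_span_singleton.1 hx
      refine (LinearPMap.mkSpanSingleton'_apply v (A.gauge v) _ c hx).trans_le ?_
      exact mul_gauge_le he c v)
  refine ⟨f, isState_of_le_gauge he hle, ?_⟩
  have h := hf ⟨v, Submodule.mem_span_singleton_self v⟩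
  rwa [LinearPMap.mkSpanSingleton_apply] at h

lemma gNorm_le_max_gauge (he : A.unit ≠ 0) (v : V) :
    gNorm A.pos A.unit v ≤ max (A.gauge v) (A.gauge (-v)) := by
  have h₀ := gauge_neg_add_nonneg he v
  have h₁ := le_max_left (A.gauge v) (A.gauge (-v))
  have h₂ := le_max_right (A.gauge v) (A.gauge (-v))
  refine le_of_forall_pos_le_add fun ε hε => csInf_le ⟨0, fun r hr => hr.1.le⟩ ⟨?_, ?_, ?_⟩
  · linarith
  · exact mem_of_gauge_lt (by linarith)
  · rw [← sub_neg_eq_add]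
    exact mem_of_gauge_lt (by linarith)

lemma exists_state_gNorm_le_abs (he : A.unit ≠ 0) (v : V) :
    ∃ f : V →ₗ[ℝ] ℝ, IsState A f ∧ gNorm A.pos A.unit v ≤ |f v| := by
  rcases eq_or_ne v 0 with rfl | hv
  · obtain ⟨f, hf, -⟩ := exists_state_eq_gauge he he
    refine ⟨f, hf, (gNorm_le_max_gauge he 0).trans ?_⟩
    simp [gauge_zero he]
  · rcases le_total (A.gauge (-v)) (A.gauge v) with h | h
    · obtain ⟨f, hf, hfv⟩ := exists_state_eq_gauge he hv
      refine ⟨f, hf, (gNorm_le_max_gauge he v).trans ?_⟩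
      rw [max_eq_left h, hfv]
      exact le_abs_self _
    · obtain ⟨f, hf, hfv⟩ := exists_state_eq_gauge he (neg_ne_zero.2 hv)
      refine ⟨f, hf, (gNorm_le_max_gauge he v).trans ?_⟩
      rw [max_eq_right h, ← hfv, map_neg]
      exact neg_le_abs _

end AOU

section Norm

variable {X : Type*} [AddCommGroup X] [Module ℝ X]

lemma gNorm_nonneg (P : Set X) (e x : X) : 0 ≤ gNorm P e x :=
  Real.sInf_nonneg fun _ hr => hr.1.le

lemma gNorm_le {P : Set X} {e x : X} {r : ℝ} (hr : 0 < r) (h₁ : r • e - x ∈ P)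
    (h₂ : r • e + x ∈ P) : gNorm P e x ≤ r :=
  csInf_le ⟨0, fun _ hs => hs.1.le⟩ ⟨hr, h₁, h₂⟩

lemma AOU.gNorm_eq_zero_of_unit_eq_zero (A : AOU V) (h : A.unit = 0) (v : V) :
    gNorm A.pos A.unit v = 0 := by
  refine le_antisymm (le_of_forall_pos_le_add fun ε hε => ?_) (gNorm_nonneg _ _ _)
  rw [A.eq_zero_of_unit_eq_zero h v, zero_add]
  exact gNorm_le hε (by simpa [h] using A.zero_mem) (by simpa [h] using A.zero_mem)

end Norm

section Cones

variable {A : AOU V} {B : AOU W}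

@[simp]
lemma tensFun_tmul (f : V →ₗ[ℝ] ℝ) (g : W →ₗ[ℝ] ℝ) (v : V) (w : W) :
    tensFun f g (v ⊗ₜ[ℝ] w) = f v * g w := by
  simp [tensFun]

lemma tmul_mem_simpleCone {v : V} {w : W} (hv : v ∈ A.pos) (hw : w ∈ B.pos) :
    v ⊗ₜ[ℝ] w ∈ simpleCone A B :=
  ⟨1, fun _ => v, fun _ => w, fun _ => hv, fun _ => hw, by simp⟩

lemma add_mem_simpleCone {x y : V ⊗[ℝ] W} (hx : x ∈ simpleCone A B)
    (hy : y ∈ simpleCone A B) : x + y ∈ simpleCone A B := by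
  obtain ⟨n, v, w, hv, hw, rfl⟩ := hx
  obtain ⟨m, v', w', hv', hw', rfl⟩ := hy
  refine ⟨n + m, Fin.append v v', Fin.append w w', ?_, ?_, ?_⟩
  · exact Fin.addCases (by simpa using hv) (by simpa using hv')
  · exact Fin.addCases (by simpa using hw) (by simpa using hw')
  · simp [Fin.sum_univ_add]

lemma simpleCone_subset_projCone : simpleCone A B ⊆ projCone A B := fun z hz ε hε => by
  rw [TensorProduct.smul_tmul']
  exact add_mem_simpleCone hz (tmul_mem_simpleCone (A.smul_mem hε.le A.unit_mem) B.unit_mem)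

lemma simpleCone_subset_injCone : simpleCone A B ⊆ injCone A B := by
  rintro _ ⟨n, v, w, hv, hw, rfl⟩ f g hf hg
  rw [map_sum]
  refine Finset.sum_nonneg fun i _ => ?_
  rw [tensFun_tmul]
  exact mul_nonneg (hf.2 _ (hv i)) (hg.2 _ (hw i))

lemma projCone_subset_injCone : projCone A B ⊆ injCone A B := by
  intro z hz f g hf hg
  refine le_of_forall_pos_le_add fun ε hε => ?_
  have h := simpleCone_subset_injCone (hz ε hε) f g hf hg
  simpa [hf.1, hg.1] using h

/-- Order bounds of `v` and `w` multiply to an order bound of `v ⊗ w`. -/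
lemma mul_unit_sub_tmul_mem_simpleCone {v : V} {w : W} {r s : ℝ}
    (h₁ : r • A.unit - v ∈ A.pos) (h₂ : r • A.unit + v ∈ A.pos)
    (h₃ : s • B.unit - w ∈ B.pos) (h₄ : s • B.unit + w ∈ B.pos) :
    (r * s) • (A.unit ⊗ₜ[ℝ] B.unit) - v ⊗ₜ[ℝ] w ∈ simpleCone A B := by
  have half : (0 : ℝ) ≤ 1 / 2 := by norm_num
  have h := add_mem_simpleCone (tmul_mem_simpleCone (A.smul_mem half h₁) h₄)
    (tmul_mem_simpleCone (A.smul_mem half h₂) h₃)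
  convert h using 1
  simp only [TensorProduct.tmul_add, TensorProduct.tmul_sub, TensorProduct.add_tmul,
    TensorProduct.sub_tmul, smul_add, smul_sub, TensorProduct.tmul_smul,
    ← TensorProduct.smul_tmul']
  module

lemma mul_unit_add_tmul_mem_simpleCone {v : V} {w : W} {r s : ℝ}
    (h₁ : r • A.unit - v ∈ A.pos) (h₂ : r • A.unit + v ∈ A.pos)
    (h₃ : s • B.unit - w ∈ B.pos) (h₄ : s • B.unit + w ∈ B.pos) :
    (r * s) • (A.unit ⊗ₜ[ℝ] B.unit) + v ⊗ₜ[ℝ] w ∈ simpleCone A B := by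
  have h := mul_unit_sub_tmul_mem_simpleCone (v := v) (w := -w) h₁ h₂
    (by rwa [sub_neg_eq_add]) (by rwa [← sub_eq_add_neg])
  rwa [TensorProduct.tmul_neg, sub_neg_eq_add] at h

lemma gNorm_projCone_tmul_le (A : AOU V) (B : AOU W) (v : V) (w : W) :
    gNorm (projCone A B) (A.unit ⊗ₜ[ℝ] B.unit) (v ⊗ₜ[ℝ] w)
      ≤ gNorm A.pos A.unit v * gNorm B.pos B.unit w := by
  have key : ∀ r ∈ {r : ℝ | 0 < r ∧ r • A.unit - v ∈ A.pos ∧ r • A.unit + v ∈ A.pos},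
      gNorm (projCone A B) (A.unit ⊗ₜ[ℝ] B.unit) (v ⊗ₜ[ℝ] w) ≤ r * gNorm B.pos B.unit w := by
    rintro r ⟨hr, h₁, h₂⟩
    rw [← div_le_iff₀' hr]
    refine le_csInf (B.exists_bound w) ?_
    rintro s ⟨hs, h₃, h₄⟩
    rw [div_le_iff₀' hr]
    exact gNorm_le (mul_pos hr hs)
      (simpleCone_subset_projCone (mul_unit_sub_tmul_mem_simpleCone h₁ h₂ h₃ h₄))
      (simpleCone_subset_projCone (mul_unit_add_tmul_mem_simpleCone h₁ h₂ h₃ h₄))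
  rcases (gNorm_nonneg B.pos B.unit w).eq_or_lt with h | h
  · obtain ⟨r, hr⟩ := A.exists_bound v
    simpa [← h] using key r hr
  · rw [← div_le_iff₀ h]
    exact le_csInf (A.exists_bound v) fun r hr => (div_le_iff₀ h).2 (key r hr)

lemma exists_bound_projCone (A : AOU V) (B : AOU W) (z : V ⊗[ℝ] W) :
    {r : ℝ | 0 < r ∧ r • (A.unit ⊗ₜ[ℝ] B.unit) - z ∈ projCone A B ∧
      r • (A.unit ⊗ₜ[ℝ] B.unit) + z ∈ projCone A B}.Nonempty := by
  suffices h : ∃ r : ℝ, 0 < r ∧ r • (A.unit ⊗ₜ[ℝ] B.unit) - z ∈ simpleCone A B ∧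
      r • (A.unit ⊗ₜ[ℝ] B.unit) + z ∈ simpleCone A B by
    obtain ⟨r, hr, h₁, h₂⟩ := h
    exact ⟨r, hr, simpleCone_subset_projCone h₁, simpleCone_subset_projCone h₂⟩
  induction z with
  | zero =>
    have h := tmul_mem_simpleCone A.unit_mem B.unit_mem
    exact ⟨1, one_pos, by simpa using h, by simpa using h⟩
  | tmul v w =>
    obtain ⟨r, hr, h₁, h₂⟩ := A.exists_bound v
    obtain ⟨s, hs, h₃, h₄⟩ := B.exists_bound w
    exact ⟨r * s, mul_pos hr hs, mul_unit_sub_tmul_mem_simpleCone h₁ h₂ h₃ h₄,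
      mul_unit_add_tmul_mem_simpleCone h₁ h₂ h₃ h₄⟩
  | add x y hx hy =>
    obtain ⟨r, hr, h₁, h₂⟩ := hx
    obtain ⟨s, hs, h₃, h₄⟩ := hy
    refine ⟨r + s, add_pos hr hs, ?_, ?_⟩
    · convert add_mem_simpleCone h₁ h₃ using 1; module
    · convert add_mem_simpleCone h₂ h₄ using 1; module

lemma gNorm_injCone_le_gNorm_projCone (A : AOU V) (B : AOU W) (z : V ⊗[ℝ] W) :
    gNorm (injCone A B) (A.unit ⊗ₜ[ℝ] B.unit) z
      ≤ gNorm (projCone A B) (A.unit ⊗ₜ[ℝ] B.unit) z :=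
  le_csInf (exists_bound_projCone A B z) fun _ hr =>
    gNorm_le hr.1 (projCone_subset_injCone hr.2.1) (projCone_subset_injCone hr.2.2)

lemma le_gNorm_injCone_tmul (A : AOU V) (B : AOU W) (v : V) (w : W) :
    gNorm A.pos A.unit v * gNorm B.pos B.unit w
      ≤ gNorm (injCone A B) (A.unit ⊗ₜ[ℝ] B.unit) (v ⊗ₜ[ℝ] w) := by
  by_cases hA : A.unit = 0
  · rw [A.gNorm_eq_zero_of_unit_eq_zero hA, zero_mul]
    exact gNorm_nonneg _ _ _
  by_cases hB : B.unit = 0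
  · rw [B.gNorm_eq_zero_of_unit_eq_zero hB, mul_zero]
    exact gNorm_nonneg _ _ _
  obtain ⟨f, hf, hfv⟩ := AOU.exists_state_gNorm_le_abs hA v
  obtain ⟨g, hg, hgw⟩ := AOU.exists_state_gNorm_le_abs hB w
  obtain ⟨r₀, h₀, h₁, h₂⟩ := exists_bound_projCone A B (v ⊗ₜ[ℝ] w)
  refine le_csInf ⟨r₀, h₀, projCone_subset_injCone h₁, projCone_subset_injCone h₂⟩ ?_
  rintro r ⟨-, hr₁, hr₂⟩
  have k₁ := hr₁ f g hf hg
  have k₂ := hr₂ f g hf hg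
  simp only [map_sub, map_add, map_smul, tensFun_tmul, hf.1, hg.1, smul_eq_mul, mul_one] at k₁ k₂
  calc gNorm A.pos A.unit v * gNorm B.pos B.unit w
      ≤ |f v| * |g w| := mul_le_mul hfv hgw (gNorm_nonneg _ _ _) (abs_nonneg _)
    _ = |f v * g w| := (abs_mul _ _).symm
    _ ≤ r := abs_le.2 ⟨by linarith, by linarith⟩

end Cones

/-- the order norms of the injective and projective tensor products are
cross norms, and the injective order norm is dominated by the projective one. -/
theorem tensor_order_norms_cross (A : AOU V) (B : AOU W) :
    (∀ (v : V) (w : W),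
      gNorm (injCone A B) (A.unit ⊗ₜ[ℝ] B.unit) (v ⊗ₜ[ℝ] w)
        = gNorm A.pos A.unit v * gNorm B.pos B.unit w) ∧
    (∀ (v : V) (w : W),
      gNorm (projCone A B) (A.unit ⊗ₜ[ℝ] B.unit) (v ⊗ₜ[ℝ] w)
        = gNorm A.pos A.unit v * gNorm B.pos B.unit w) ∧
    (∀ z : TensorProduct ℝ V W,
      gNorm (injCone A B) (A.unit ⊗ₜ[ℝ] B.unit) z
        ≤ gNorm (projCone A B) (A.unit ⊗ₜ[ℝ] B.unit) z) := by
  exact ⟨fun v w => le_antisymm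
      ((gNorm_injCone_le_gNorm_projCone A B _).trans (gNorm_projCone_tmul_le A B v w))
      (le_gNorm_injCone_tmul A B v w),
    fun v w => le_antisymm (gNorm_projCone_tmul_le A B v w)
      ((le_gNorm_injCone_tmul A B v w).trans (gNorm_injCone_le_gNorm_projCone A B _)),
    gNorm_injCone_le_gNorm_projCone A B⟩
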